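/- Suppose t > 0, |t'| ≤ t/2, U ≥ 4V ≥ 0, and Q ∈ (0, π). With g₀ᶜ = a²(U/2 + 2V) and g₁ᶜ = a²(U/2 + 2V(2 - cos(2Q))), and the dimensionless couplings γ₀ᶜ = 2g₀ᶜ/(v_F·π·ã), γ₁ᶜ = g₁ᶜ/(v_F·π·ã) (with v_F·π·ã > 0), the inequality |γ₁ᶜ| < |1 + γ₀ᶜ| holds. In particular the constraint needed for the charge sector Bogoliubov diagonalization is automatically satisfied. -/

import Mathlib

open Real

/-- For t > 0, |t'| ≤ t/2, U ≥ 4V ≥ 0, Q ∈ (0,π), the dimensionless charge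
    couplings γ₀ᶜ = 2g₀ᶜ/(v_F π ã), γ₁ᶜ = g₁ᶜ/(v_F π ã) with
    g₀ᶜ = a²(U/2 + 2V), g₁ᶜ = a²(U/2 + 2V(2 - cos 2Q)) satisfy
    |γ₁ᶜ| < |1 + γ₀ᶜ|: the charge-sector Bogoliubov constraint holds
    automatically. -/
theorem stmt_17 (a t t' U V Q atil : ℝ) (ha : 0 < a) (hatil : 0 < atil)
    (ht : 0 < t) (ht' : |t'| ≤ t / 2) (hUV : 4 * V ≤ U) (hV : 0 ≤ V)
    (hQ0 : 0 < Q) (hQπ : Q < π) :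
    let vF : ℝ := 2 * Real.sqrt 2 * Real.sin Q * (t + 2 * t' * Real.cos Q) * a
    let g0 : ℝ := a ^ 2 * (U / 2 + 2 * V)
    let g1 : ℝ := a ^ 2 * (U / 2 + 2 * V * (2 - Real.cos (2 * Q)))
    let γ0 : ℝ := 2 * g0 / (vF * π * atil)
    let γ1 : ℝ := g1 / (vF * π * atil)
    |γ1| < |1 + γ0| := by
  intro vF g0 g1 γ0 γ1
  have hs : 0 < Real.sin Q := Real.sin_pos_of_pos_of_lt_pi hQ0 hQπ
  have hc : |Real.cos Q| < 1 := by
    rw [abs_lt]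
    constructor <;> nlinarith [Real.sin_sq_add_cos_sq Q, Real.neg_one_le_cos Q, Real.cos_le_one Q]
  have hk : 0 < t + 2 * t' * Real.cos Q := by
    have h1 : |t' * Real.cos Q| ≤ t / 2 * |Real.cos Q| := by
      rw [abs_mul]
      exact mul_le_mul_of_nonneg_right ht' (abs_nonneg _)
    have h2 := neg_abs_le (t' * Real.cos Q)
    nlinarith
  have hvF : 0 < vF := by
    simp only [vF]
    positivity
  have hD : 0 < vF * π * atil := by
    have := Real.pi_pos
    positivity
  have hc1 := Real.neg_one_le_cos (2 * Q)
  have hc2 := Real.cos_le_one (2 * Q)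
  have ha2 : 0 ≤ a ^ 2 := sq_nonneg a
  have hg1 : 0 ≤ g1 := mul_nonneg ha2 (by nlinarith)
  have hle : g1 ≤ 2 * g0 := by
    have : a ^ 2 * (U / 2 + 2 * V * (2 - Real.cos (2 * Q))) ≤ a ^ 2 * (2 * (U / 2 + 2 * V)) :=
      mul_le_mul_of_nonneg_left (by nlinarith) ha2
    simp only [g1, g0]
    linarith
  have h1 : 0 ≤ γ1 := div_nonneg hg1 hD.le
  have h2 : γ1 ≤ γ0 := div_le_div_of_nonneg_right hle hD.le
  rw [abs_of_nonneg h1, abs_of_nonneg (by linarith)]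
  linarith
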